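/- arXiv:2505.16015 — 6 statements merged into one kernel-verified Lean document; each statement's English description precedes it below -/
import Mathlib

section
/- Let G be a connected simple graph on Fin n with n ≥ 2, with m edges, diameter Δ, and suppose G is κ-connected for some κ ≥ 1 (i.e., for every vertex subset S with |S| < κ, the subgraph induced on the complement of S is connected). Then the algebraic connectivity satisfies a₁(G) ≤ 12·m / (κ·Δ·(Δ − 1)·(Δ − 2) + 6·Δ²). -/
open Classical in
/-- The Laplacian quadratic form `⟨L(G) x, x⟩`. -/
noncomputable def lapQuad {m : ℕ} (G : SimpleGraph (Fin m)) (x : Fin m → ℝ) : ℝ :=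
  ∑ i, (SimpleGraph.lapMatrix ℝ G).mulVec x i * x i

/-- The algebraic connectivity `a₁(G)`: the minimum of the Rayleigh quotient
`⟨L(G)x, x⟩ / ⟨x, x⟩` over nonzero `x` with `∑ i, x i = 0` (for a connected graph on
at least two vertices this is the second-smallest Laplacian eigenvalue). -/
noncomputable def algConn {m : ℕ} (G : SimpleGraph (Fin m)) : ℝ :=
  sInf {r : ℝ | ∃ x : Fin m → ℝ, x ≠ 0 ∧ (∑ i, x i) = 0 ∧
    r = lapQuad G x / (∑ i, x i * x i)}

theorem lapQuad_eq {n : ℕ} (G : SimpleGraph (Fin n)) [DecidableRel G.Adj] (x : Fin n → ℝ) :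
    lapQuad G x = (∑ i, ∑ j, if G.Adj i j then (x i - x j) ^ 2 else 0) / 2 := by
  classical
  rw [← SimpleGraph.lapMatrix_toLinearMap₂', Matrix.toLinearMap₂'_apply']
  simp only [lapQuad, dotProduct]
  refine Finset.sum_congr rfl fun i _ => ?_
  rw [mul_comm]
  congr!

/-- The edges of `G` bound the Laplacian energy of a function that is 1-Lipschitz along edges. -/
theorem lapQuad_le_card_edgeFinset {n : ℕ} (G : SimpleGraph (Fin n)) [Fintype G.edgeSet]
    (x : Fin n → ℝ) (hx : ∀ i j, G.Adj i j → (x i - x j) ^ 2 ≤ 1) :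
    lapQuad G x ≤ G.edgeFinset.card := by
  classical
  have hdeg : (∑ i, ∑ j, if G.Adj i j then (1 : ℝ) else 0) = 2 * G.edgeFinset.card := by
    simp_rw [← G.degree_eq_sum_if_adj]
    exact_mod_cast G.sum_degrees_eq_twice_card_edges.trans (by congr!)
  rw [lapQuad_eq]
  have : (∑ i, ∑ j, if G.Adj i j then (x i - x j) ^ 2 else 0) ≤
      ∑ i, ∑ j, if G.Adj i j then (1 : ℝ) else 0 := by
    gcongr with i _ j _
    split_ifs with h
    exacts [hx i j h, le_rfl]
  linarith

theorem lapQuad_nonneg {n : ℕ} (G : SimpleGraph (Fin n)) (x : Fin n → ℝ) : 0 ≤ lapQuad G x := by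
  classical
  rw [lapQuad_eq]
  exact div_nonneg (Finset.sum_nonneg fun i _ => Finset.sum_nonneg fun j _ => by positivity)
    two_pos.le

/-- The Rayleigh quotient of the centred function bounds `algConn`. -/
theorem algConn_le_div {n : ℕ} (G : SimpleGraph (Fin n)) (u : Fin n → ℝ) {M N : ℝ}
    (hN : 0 < N) (hM : ∀ c, lapQuad G (fun i => u i - c) ≤ M)
    (hu : ∀ c, N ≤ ∑ i, (u i - c) ^ 2) : algConn G ≤ M / N := by
  set c : ℝ := (∑ i, u i) / n
  have hpos := hN.trans_le (hu c)
  have hn : (n : ℝ) ≠ 0 := by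
    rintro h
    obtain rfl : n = 0 := by exact_mod_cast h
    simp at hpos
  have hmem : algConn G ≤ lapQuad G (fun i => u i - c) / ∑ i, (u i - c) ^ 2 := by
    refine csInf_le ⟨0, ?_⟩ ⟨fun i => u i - c, ?_, ?_, by simp only [sq]⟩
    · rintro _ ⟨x, -, -, rfl⟩
      exact div_nonneg (lapQuad_nonneg G x) (Finset.sum_nonneg fun i _ => mul_self_nonneg _)
    · intro h
      simp [fun i => congrFun h i] at hpos
    · simp [Finset.sum_sub_distrib, c, mul_div_cancel₀ _ hn]
  exact hmem.trans (div_le_div₀ ((lapQuad_nonneg G _).trans (hM c)) (hM c) hN (hu c))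

/-- Every intermediate sphere between two vertices separates them. -/
theorem card_sphere_ge {n : ℕ} (G : SimpleGraph (Fin n)) (hG : G.Connected) {κ : ℕ}
    (hκ : ∀ S : Finset (Fin n), S.card < κ → (G.induce ((↑S : Set (Fin n))ᶜ)).Connected)
    {p q : Fin n} {i : ℕ} (hi : 0 < i) (hiq : i < G.dist p q) :
    κ ≤ (Finset.univ.filter fun x => G.dist p x = i).card := by
  by_contra! h
  have hreach := (hκ _ h).preconnected
    ⟨p, by simpa using hi.ne⟩ ⟨q, by simpa using hiq.ne'⟩
  have hstay : ∀ a b, (G.induce ((↑(Finset.univ.filter fun x => G.dist p x = i) :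
      Set (Fin n))ᶜ)).Walk a b → G.dist p a < i → G.dist p b < i := by
    intro a b w
    induction w with
    | nil => exact id
    | @cons a b _ hab _ ih =>
      intro ha
      have hb : G.dist p b ≠ i := by simpa using b.2
      have hadj : G.dist a.1 b = 1 := SimpleGraph.dist_eq_one_iff_adj.2 hab
      have := hG.dist_triangle (u := p) (v := a) (w := b)
      exact ih (by omega)
  obtain ⟨w⟩ := hreach
  have := hstay _ _ w (by simpa using hi)
  simp only at this
  omega

theorem sum_range_succ_sub_sq (k : ℕ) (c : ℝ) :
    ∑ i ∈ Finset.range k, ((i : ℝ) + 1 - c) ^ 2 =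
      k * (c - (k + 1) / 2) ^ 2 + (k + 1) * k * (k - 1) / 12 := by
  induction k with
  | zero => simp
  | succ k ih =>
    rw [Finset.sum_range_succ, ih]
    push_cast
    ring

theorem sum_dist_sub_sq_ge {n : ℕ} (G : SimpleGraph (Fin n)) (hG : G.Connected) {κ k : ℕ}
    (hκ : ∀ S : Finset (Fin n), S.card < κ → (G.induce ((↑S : Set (Fin n))ᶜ)).Connected)
    {p q : Fin n} (hpq : G.dist p q = k + 1) (c : ℝ) :
    (κ * (k + 1) * k * (k - 1) + 6 * (k + 1) ^ 2) / 12 ≤ ∑ x, ((G.dist p x : ℝ) - c) ^ 2 := by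
  classical
  set V : ℕ → Finset (Fin n) := fun i => Finset.univ.filter fun x => G.dist p x = i
  have hfiber : ∑ i ∈ Finset.range (k + 2), ((V i).card : ℝ) * ((i : ℝ) - c) ^ 2 ≤
      ∑ x, ((G.dist p x : ℝ) - c) ^ 2 := by
    calc _ = ∑ i ∈ Finset.range (k + 2), ∑ x ∈ V i, ((G.dist p x : ℝ) - c) ^ 2 := by
          refine Finset.sum_congr rfl fun i _ => ?_
          rw [← nsmul_eq_mul, ← Finset.sum_const]
          refine Finset.sum_congr rfl fun x hx => ?_
          rw [(Finset.mem_filter.1 hx).2]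
      _ = ∑ x with G.dist p x ∈ Finset.range (k + 2), ((G.dist p x : ℝ) - c) ^ 2 :=
          Finset.sum_fiberwise_eq_sum_filter _ _ _ _
      _ ≤ _ := Finset.sum_le_sum_of_subset_of_nonneg (Finset.filter_subset _ _)
          fun _ _ _ => sq_nonneg _
  refine le_trans ?_ hfiber
  rw [Finset.sum_range_succ, Finset.sum_range_succ']
  have h0 : (1 : ℝ) ≤ (V 0).card := by
    exact_mod_cast Finset.card_pos.2 ⟨p, by simp [V]⟩
  have hlast : (1 : ℝ) ≤ (V (k + 1)).card := by
    exact_mod_cast Finset.card_pos.2 ⟨q, by simp [V, hpq]⟩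
  have hmid : κ * ∑ i ∈ Finset.range k, ((i : ℝ) + 1 - c) ^ 2 ≤
      ∑ i ∈ Finset.range k, ((V (i + 1)).card : ℝ) * (((i + 1 : ℕ) : ℝ) - c) ^ 2 := by
    rw [Finset.mul_sum]
    refine Finset.sum_le_sum fun i hi => ?_
    push_cast
    gcongr
    exact card_sphere_ge G hG hκ (q := q) i.succ_pos (by have := Finset.mem_range.1 hi; omega)
  rw [sum_range_succ_sub_sq] at hmid
  have hκk : 0 ≤ (κ : ℝ) * (k * (c - (k + 1) / 2) ^ 2) := by positivity
  have e0 := mul_le_mul_of_nonneg_right h0 (sq_nonneg (((0 : ℕ) : ℝ) - c))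
  have e1 := mul_le_mul_of_nonneg_right hlast (sq_nonneg (((k + 1 : ℕ) : ℝ) - c))
  push_cast at *
  nlinarith [sq_nonneg (c - (k + 1) / 2)]

open Classical in
/-- A connected graph `G` on `n ≥ 2` vertices with `m` edges, diameter `Δ`
and vertex connectivity at least `κ ≥ 1` satisfies
`a₁(G) ≤ 12 m / (κ Δ (Δ-1) (Δ-2) + 6 Δ²)`. -/
theorem algConn_le_of_diam_connectivity (n : ℕ) (hn : 2 ≤ n)
    (G : SimpleGraph (Fin n)) (hG : G.Connected)
    (m : ℕ) (hm : m = G.edgeFinset.card)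
    (Δ : ℕ) (hΔ : Δ = G.diam)
    (κ : ℕ) (hκ : 1 ≤ κ)
    (hκconn : ∀ S : Finset (Fin n), S.card < κ →
      (G.induce ((↑S : Set (Fin n))ᶜ)).Connected) :
    algConn G ≤ 12 * (m : ℝ) /
      ((κ : ℝ) * (Δ : ℝ) * ((Δ : ℝ) - 1) * ((Δ : ℝ) - 2) + 6 * (Δ : ℝ) ^ 2) := by
  subst hm hΔ
  have : Nonempty (Fin n) := ⟨⟨0, by omega⟩⟩
  obtain ⟨p, q, hpq⟩ := G.exists_dist_eq_diam
  have : Nontrivial (Fin n) := Fin.nontrivial_iff_two_le.2 hn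
  obtain ⟨k, hk⟩ := Nat.exists_eq_succ_of_ne_zero (SimpleGraph.connected_iff_diam_ne_zero.1 hG)
  have hN : 0 < (κ * (k + 1) * k * (k - 1) + 6 * (k + 1) ^ 2 : ℝ) / 12 := by
    have : 0 ≤ (k : ℝ) * (k - 1) := by
      rcases k with _ | k
      · simp
      · push_cast
        simp only [add_sub_cancel_right]
        positivity
    have : 0 ≤ (κ : ℝ) * (k + 1) * (k * (k - 1)) := by positivity
    nlinarith [sq_nonneg (k : ℝ)]
  refine (algConn_le_div G (fun x => (G.dist p x : ℝ)) hN (M := G.edgeFinset.card) (fun c => ?_)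
    (sum_dist_sub_sq_ge G hG hκconn (hpq.trans hk))).trans_eq ?_
  · refine lapQuad_le_card_edgeFinset G _ fun i j hij => ?_
    have hij' := SimpleGraph.dist_eq_one_iff_adj.2 hij
    have h1 := hG.dist_triangle (u := p) (v := i) (w := j)
    have h2 := hG.dist_triangle (u := p) (v := j) (w := i)
    rw [G.dist_comm (u := j)] at h2
    rw [hij', ← Nat.cast_le (α := ℝ)] at h1 h2
    push_cast at h1 h2
    rw [sub_sub_sub_cancel_right, sq_le_one_iff_abs_le_one, abs_le]
    constructor <;> linarith
  · rw [hk]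
    push_cast
    rw [div_div_eq_mul_div]
    ring_nf
end

section
/- Let d, n ∈ ℕ with n ≥ d + 1 and let P_{n,d} be the generalized path graph. Then for every vertex i with 1 ≤ i ≤ n, the graph distance from vertex 1 to vertex i equals ⌈(i − 1)/d⌉. -/
/-- The generalized path graph `P_{n,d}` on vertex set `Fin n` (vertex `i` stands for the
label `i + 1 ∈ {1, …, n}`): two vertices are adjacent iff their labels differ by at most
`d` (and at least `1`). -/
def genPath (n d : ℕ) : SimpleGraph (Fin n) :=
  SimpleGraph.fromRel (fun i j => (i : ℕ) < (j : ℕ) ∧ (j : ℕ) - (i : ℕ) ≤ d)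

theorem genPath_adj {n d : ℕ} {i j : Fin n} :
    (genPath n d).Adj i j ↔ i ≠ j ∧ (i : ℕ) ≤ j + d ∧ (j : ℕ) ≤ i + d := by
  simp only [genPath, SimpleGraph.fromRel_adj, ne_eq, Fin.ext_iff]
  omega

theorem genPath_walk_le {n d : ℕ} {u v : Fin n} (p : (genPath n d).Walk u v) :
    (v : ℕ) ≤ u + p.length * d := by
  induction p with
  | nil => simp
  | cons h p ih =>
    have := (genPath_adj.1 h).2.2
    rw [SimpleGraph.Walk.length_cons, add_mul]
    omega

theorem genPath_exists_walk {n d : ℕ} (hd : 1 ≤ d) (hn : 0 < n) (k : ℕ) (i : Fin n)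
    (hi : (i : ℕ) ≤ k * d) : ∃ p : (genPath n d).Walk ⟨0, hn⟩ i, p.length ≤ k := by
  induction k generalizing i with
  | zero =>
    obtain rfl : i = ⟨0, hn⟩ := Fin.ext (by simpa using hi)
    exact ⟨.nil, le_rfl⟩
  | succ k ih =>
    by_cases hk : (i : ℕ) ≤ k * d
    · obtain ⟨p, hp⟩ := ih i hk
      exact ⟨p, by omega⟩
    · rw [add_mul] at hi
      have hj : (i : ℕ) - d < n := by omega
      obtain ⟨p, hp⟩ := ih ⟨i - d, hj⟩ (by simp only; omega)
      have h : (genPath n d).Adj ⟨i - d, hj⟩ i := by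
        simp only [genPath_adj, ne_eq, Fin.ext_iff]
        omega
      exact ⟨p.concat h, by rw [SimpleGraph.Walk.length_concat]; omega⟩

/-- In the generalized path graph `P_{n,d}` (`n ≥ d + 1`, `d ≥ 1`), the
graph distance from vertex `1` to vertex `i` (labels in `{1, …, n}`; vertex of label `i`
is the index `i - 1 : Fin n`) equals `⌈(i - 1)/d⌉`. -/
theorem genPath_dist_from_first (d n : ℕ) (hd : 1 ≤ d) (hn : d + 1 ≤ n) :
    ∀ i : Fin n, ((genPath n d).dist ⟨0, by omega⟩ i : ℤ) = ⌈((i : ℕ) : ℝ) / (d : ℝ)⌉ := by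
  intro i
  have hn0 : 0 < n := by omega
  have hd0 : (0 : ℝ) < d := by exact_mod_cast hd
  apply le_antisymm
  · obtain ⟨p, hp⟩ := genPath_exists_walk hd hn0 ⌈((i : ℕ) : ℝ) / (d : ℝ)⌉₊ i (by
      have := (div_le_iff₀ hd0).1 (Nat.le_ceil (((i : ℕ) : ℝ) / (d : ℝ)))
      exact_mod_cast this)
    rw [← Int.natCast_ceil_eq_ceil (by positivity)]
    exact_mod_cast (SimpleGraph.dist_le p).trans hp
  · obtain ⟨p, -⟩ := genPath_exists_walk hd hn0 i i (Nat.le_mul_of_pos_right _ hd)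
    obtain ⟨q, hq⟩ := p.reachable.exists_walk_length_eq_dist
    have := genPath_walk_le q
    rw [hq, zero_add] at this
    rw [Int.ceil_le, div_le_iff₀ hd0]
    exact_mod_cast this
end

section
/- Let d, n ∈ ℕ with n ≥ d + 1 and let C_{n,d} be the generalized cycle graph. If n ≤ 2d + 1 then the algebraic connectivity satisfies a₁(C_{n,d}) = n, and if n ≥ 2d + 2 then a₁(C_{n,d}) = Σ_{k=1}^{d} 2·(1 − cos(2·k·π/n)). -/
/-- The generalized cycle graph `C_{n,d}` on vertex set `Fin n`: distinct vertices `i, j`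
are adjacent iff `(j - i) mod n ∈ {1, …, d}` or `(i - j) mod n ∈ {1, …, d}`. -/
def genCycle (n d : ℕ) : SimpleGraph (Fin n) :=
  SimpleGraph.fromRel (fun i j => ∃ k : ℕ, 1 ≤ k ∧ k ≤ d ∧ ((i : ℕ) + k) % n = (j : ℕ))
/-- The Dirichlet kernel identity. -/
theorem sin_mul_one_add_sum_cos (φ : ℝ) (d : ℕ) :
    Real.sin φ * (1 + ∑ k ∈ Finset.Icc 1 d, 2 * Real.cos (2 * k * φ)) =
      Real.sin ((2 * d + 1) * φ) := by
  induction d with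
  | zero => simp
  | succ d ih =>
    rw [Finset.sum_Icc_succ_top (by omega), ← add_assoc, mul_add, ih]
    have h1 : (2 * (d : ℝ) + 1) * φ = 2 * ((d + 1 : ℕ) : ℝ) * φ - φ := by push_cast; ring
    have h2 : (2 * ((d + 1 : ℕ) : ℝ) + 1) * φ = 2 * ((d + 1 : ℕ) : ℝ) * φ + φ := by ring
    rw [h1, h2, Real.sin_sub, Real.sin_add]
    ring

theorem two_mul_sin_half_mul_sum_cos (α : ℝ) (N : ℕ) :
    2 * Real.sin (α / 2) * ∑ m ∈ Finset.range N, Real.cos (m * α) =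
      Real.sin (N * α - α / 2) + Real.sin (α / 2) := by
  induction N with
  | zero => simp [Real.sin_neg]
  | succ N ih =>
    rw [Finset.sum_range_succ, mul_add, ih]
    have h : ((N + 1 : ℕ) : ℝ) * α - α / 2 = N * α + α / 2 := by push_cast; ring
    rw [h, Real.sin_sub, Real.sin_add]
    ring

/-- Orthogonality of the characters of `ℤ / n`, in real form. -/
theorem sum_cos_eq_ite (n : ℕ) (hn : 0 < n) (t : ℤ) :
    ∑ m ∈ Finset.range n, Real.cos (2 * Real.pi * m * t / n) =
      if (n : ℤ) ∣ t then (n : ℝ) else 0 := by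
  have hn' : (n : ℝ) ≠ 0 := by positivity
  split_ifs with h
  · obtain ⟨c, rfl⟩ := h
    rw [Finset.sum_congr rfl (g := fun _ => (1 : ℝ))]
    · simp
    · intro m _
      have h : 2 * Real.pi * m * ((n * c : ℤ) : ℝ) / n = ((m * c : ℤ) : ℝ) * (2 * Real.pi) := by
        push_cast
        field_simp
      rw [h, Real.cos_int_mul_two_pi]
  · have key := two_mul_sin_half_mul_sum_cos (2 * Real.pi * t / n) n
    have h1 : n * (2 * Real.pi * t / n) - 2 * Real.pi * t / n / 2
        = (t : ℝ) * (2 * Real.pi) - 2 * Real.pi * t / n / 2 := by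
      field_simp
    rw [h1, Real.sin_int_mul_two_pi_sub, neg_add_cancel] at key
    have h2 : Real.sin (2 * Real.pi * t / n / 2) ≠ 0 := by
      rw [Ne, Real.sin_eq_zero_iff]
      rintro ⟨c, hc⟩
      apply h
      refine ⟨c, ?_⟩
      have : (t : ℝ) = n * c := by
        field_simp at hc
        linarith
      exact_mod_cast this
    rcases mul_eq_zero.mp key with h3 | h3
    · simp_all
    · rw [← h3]
      refine Finset.sum_congr rfl fun m _ => ?_
      congr 1
      ring

/-- The ratio `sin (m x) / sin x` is antitone as long as `m x ≤ π`. -/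
theorem sin_nat_mul_mul_sin_le (m : ℕ) (x y : ℝ) (hx : 0 ≤ x) (hxy : x ≤ y)
    (hy : y ≤ Real.pi) (h : m * y ≤ Real.pi) :
    Real.sin (m * y) * Real.sin x ≤ Real.sin (m * x) * Real.sin y := by
  induction m with
  | zero => simp
  | succ m ih =>
    push_cast at h ⊢
    rcases Nat.eq_zero_or_pos m with rfl | hm
    · simp [mul_comm]
    have hm1 : (1 : ℝ) ≤ m := by exact_mod_cast hm
    have hmy : m * y ≤ Real.pi := by nlinarith
    have hy2 : y ≤ Real.pi / 2 := by nlinarith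
    have h0 := ih hmy
    have hc : Real.cos (m * y) ≤ Real.cos (m * x) :=
      Real.cos_le_cos_of_nonneg_of_le_pi (by positivity) hmy (by gcongr)
    have hc' : Real.cos y ≤ Real.cos x := Real.cos_le_cos_of_nonneg_of_le_pi hx hy hxy
    have hcy : 0 ≤ Real.cos y := Real.cos_nonneg_of_neg_pi_div_two_le_of_le (by linarith) hy2
    have hsx : 0 ≤ Real.sin x := Real.sin_nonneg_of_nonneg_of_le_pi hx (by linarith)
    have hsy : 0 ≤ Real.sin y := Real.sin_nonneg_of_nonneg_of_le_pi (by linarith) hy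
    have hsmx : 0 ≤ Real.sin (m * x) :=
      Real.sin_nonneg_of_nonneg_of_le_pi (by positivity) (by nlinarith)
    rw [add_mul, add_mul, one_mul, one_mul, Real.sin_add, Real.sin_add]
    have e1 := mul_le_mul_of_nonneg_right h0 hcy
    have e2 := mul_le_mul_of_nonneg_left hc' (mul_nonneg hsmx hsy)
    have e3 := mul_le_mul_of_nonneg_right hc (mul_nonneg hsx hsy)
    nlinarith

theorem abs_sin_mul_sin_le_of_le_half {n p j : ℕ} (hp : 1 ≤ p) (hj : 1 ≤ j)
    (hpn : 2 * p ≤ n) (hjn : 2 * j ≤ n) :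
    |Real.sin (p * (j * (Real.pi / n)))| * Real.sin (Real.pi / n) ≤
      Real.sin (p * (Real.pi / n)) * Real.sin (j * (Real.pi / n)) := by
  have hn : (0 : ℝ) < n := by
    have : 0 < n := by omega
    exact_mod_cast this
  have hp1 : (1 : ℝ) ≤ p := by exact_mod_cast hp
  have hj1 : (1 : ℝ) ≤ j := by exact_mod_cast hj
  have hpn' : 2 * (p : ℝ) ≤ n := by exact_mod_cast hpn
  have hjn' : 2 * (j : ℝ) ≤ n := by exact_mod_cast hjn
  have hpi := Real.pi_pos
  have hθ : 0 < Real.pi / n := by positivity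
  have hnθ : n * (Real.pi / n) = Real.pi := by field_simp
  rcases le_total (p * j) n with h | h
  · have h' : (p : ℝ) * j ≤ n := by exact_mod_cast h
    have hle : (p : ℝ) * (j * (Real.pi / n)) ≤ Real.pi := by
      rw [← mul_assoc]
      calc (p : ℝ) * j * (Real.pi / n) ≤ n * (Real.pi / n) := by gcongr
        _ = Real.pi := hnθ
    rw [abs_of_nonneg (Real.sin_nonneg_of_nonneg_of_le_pi (by positivity) hle)]
    refine sin_nat_mul_mul_sin_le p _ _ hθ.le ?_ ?_ hle
    · nlinarith
    · nlinarith
  · have h' : (n : ℝ) ≤ p * j := by exact_mod_cast h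
    have hθ2 : Real.sin (Real.pi / n) ≤ 4 / n := by
      refine (Real.sin_le hθ.le).trans ?_
      gcongr
      exact Real.pi_le_four
    have hbound : ∀ q : ℝ, 1 ≤ q → 2 * q ≤ n → 2 * q / n ≤ Real.sin (q * (Real.pi / n)) := by
      intro q hq hqn
      have := Real.mul_le_sin (x := q * (Real.pi / n)) (by positivity) (by nlinarith)
      calc 2 * q / n = 2 / Real.pi * (q * (Real.pi / n)) := by field_simp
        _ ≤ _ := this
    have b1 := hbound p hp1 hpn'
    have b2 := hbound j hj1 hjn'
    calc |Real.sin (p * (j * (Real.pi / n)))| * Real.sin (Real.pi / n)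
        ≤ 1 * (4 / n) := by
          refine mul_le_mul (Real.abs_sin_le_one _) hθ2 ?_ zero_le_one
          simpa using (show (0 : ℝ) ≤ 2 * 1 / n by positivity).trans
            (hbound 1 le_rfl (by linarith))
      _ ≤ (2 * p / n) * (2 * j / n) := by
          rw [div_mul_div_comm, one_mul, div_le_div_iff₀ hn (by positivity)]
          nlinarith
      _ ≤ _ := mul_le_mul b1 b2 (by positivity) (le_trans (by positivity) b1)

theorem abs_sin_int_mul_pi_sub (k : ℤ) (x : ℝ) : |Real.sin (k * Real.pi - x)| = |Real.sin x| := by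
  rw [Real.sin_int_mul_pi_sub, abs_neg, abs_mul]
  rcases Int.even_or_odd k with h | h <;> simp [h.neg_one_zpow]

theorem abs_sin_mul_sin_le {n p j : ℕ} (hp : 1 ≤ p) (hj : 1 ≤ j) (hpn : p < n) (hjn : j < n) :
    |Real.sin (p * (j * (Real.pi / n)))| * Real.sin (Real.pi / n) ≤
      Real.sin (p * (Real.pi / n)) * Real.sin (j * (Real.pi / n)) := by
  have hn : (n : ℝ) ≠ 0 := by
    have : n ≠ 0 := by omega
    exact_mod_cast this
  have hsin : ∀ q ≤ n, Real.sin ((n - q : ℕ) * (Real.pi / n)) = Real.sin (q * (Real.pi / n)) := by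
    intro q hq
    rw [← Real.sin_pi_sub]
    congr 1
    push_cast [hq]
    field_simp
    ring
  have hsin2 : ∀ q r : ℕ, q ≤ n → |Real.sin ((n - q : ℕ) * (r * (Real.pi / n)))| =
      |Real.sin (q * (r * (Real.pi / n)))| := by
    intro q r hq
    rw [← abs_sin_int_mul_pi_sub r (q * (r * (Real.pi / n)))]
    congr 2
    push_cast [hq]
    field_simp
  have hcomm : ∀ q r : ℕ, Real.sin (q * (r * (Real.pi / n))) = Real.sin (r * (q * (Real.pi / n))) := by
    intro q r
    congr 1
    ring
  have half : ∀ p j : ℕ, 1 ≤ p → 1 ≤ j → 2 * p ≤ n → j < n →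
      |Real.sin (p * (j * (Real.pi / n)))| * Real.sin (Real.pi / n) ≤
      Real.sin (p * (Real.pi / n)) * Real.sin (j * (Real.pi / n)) := by
    intro p j hp hj hpn hjn
    rcases le_total (2 * j) n with h | h
    · exact abs_sin_mul_sin_le_of_le_half hp hj hpn h
    · rw [← hsin j hjn.le, hcomm, ← hsin2 j p hjn.le, hcomm]
      exact abs_sin_mul_sin_le_of_le_half hp (by omega) hpn (by omega)
  rcases le_total (2 * p) n with h | h
  · exact half p j hp hj h hjn
  · rw [← hsin p hpn.le, ← hsin2 p j hpn.le]
    exact half _ j (by omega) hj (by omega) hjn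

/-- Among the nontrivial Laplacian eigenvalues of `C_{n,d}`, the one of frequency `1` is least. -/
theorem genCycle_eigenvalue_one_le {n d m : ℕ} (hn : 2 * d + 1 < n) (hm : 1 ≤ m) (hmn : m < n) :
    ∑ k ∈ Finset.Icc 1 d, 2 * (1 - Real.cos (2 * k * Real.pi / n)) ≤
      ∑ k ∈ Finset.Icc 1 d, 2 * (1 - Real.cos (2 * Real.pi * m * k / n)) := by
  have hn0 : (0 : ℝ) < n := by
    have : 0 < n := by omega
    exact_mod_cast this
  have pos : ∀ q : ℕ, 1 ≤ q → q < n → 0 < Real.sin (q * (Real.pi / n)) := by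
    intro q hq hqn
    have hq0 : (0 : ℝ) < q := by exact_mod_cast hq
    have hqn' : (q : ℝ) < n := by exact_mod_cast hqn
    apply Real.sin_pos_of_pos_of_lt_pi
    · have := Real.pi_pos
      positivity
    · rw [← mul_div_assoc, div_lt_iff₀ hn0, mul_comm]
      exact mul_lt_mul_of_pos_left hqn' Real.pi_pos
  have hs1 : 0 < Real.sin (Real.pi / n) := by simpa using pos 1 le_rfl (by omega)
  have hsm := pos m hm hmn
  have hmain := abs_sin_mul_sin_le (p := 2 * d + 1) (by omega) hm hn hmn
  have hle := (mul_le_mul_of_nonneg_right (le_abs_self _) hs1.le).trans hmain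
  push_cast at hle
  rw [← sin_mul_one_add_sum_cos, ← sin_mul_one_add_sum_cos] at hle
  have e1 : ∑ k ∈ Finset.Icc 1 d, 2 * (1 - Real.cos (2 * k * Real.pi / n)) =
      ∑ k ∈ Finset.Icc 1 d, 2 - ∑ k ∈ Finset.Icc 1 d, 2 * Real.cos (2 * k * (Real.pi / n)) := by
    rw [← Finset.sum_sub_distrib]
    refine Finset.sum_congr rfl fun k _ => ?_
    rw [← mul_div_assoc]
    ring
  have e2 : ∑ k ∈ Finset.Icc 1 d, 2 * (1 - Real.cos (2 * Real.pi * m * k / n)) =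
      ∑ k ∈ Finset.Icc 1 d, 2 -
        ∑ k ∈ Finset.Icc 1 d, 2 * Real.cos (2 * k * (m * (Real.pi / n))) := by
    rw [← Finset.sum_sub_distrib]
    refine Finset.sum_congr rfl fun k _ => ?_
    have : 2 * (k : ℝ) * (m * (Real.pi / n)) = 2 * Real.pi * m * k / n := by ring
    rw [this]
    ring
  rw [e1, e2]
  have := mul_pos hs1 hsm
  nlinarith

theorem Int.eq_zero_of_dvd_of_lt_of_lt {n t : ℤ} (h : n ∣ t) (h1 : -n < t) (h2 : t < n) :
    t = 0 :=
  Int.eq_zero_of_abs_lt_dvd h (abs_lt.mpr ⟨h1, h2⟩)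

theorem genCycle_adj_iff {n d : ℕ} (i j : Fin n) :
    (genCycle n d).Adj i j ↔ i ≠ j ∧ ∃ k ∈ Finset.Icc 1 d,
      (n : ℤ) ∣ (i : ℤ) + k - j ∨ (n : ℤ) ∣ (i : ℤ) - k - j := by
  have key : ∀ (i j : Fin n) (k : ℕ), ((i : ℕ) + k) % n = j ↔ (n : ℤ) ∣ (i : ℤ) + k - j := by
    intro i j k
    rw [← Int.modEq_iff_dvd, Int.modEq_comm, ← Nat.cast_add, Int.natCast_modEq_iff, Nat.ModEq,
      Nat.mod_eq_of_lt j.2]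
  have neg : ∀ (i j : Fin n) (k : ℕ), (n : ℤ) ∣ (j : ℤ) + k - i ↔ (n : ℤ) ∣ (i : ℤ) - k - j := by
    intro i j k
    rw [← dvd_neg]
    ring_nf
  simp only [genCycle, SimpleGraph.fromRel_adj, key, neg, Finset.mem_Icc, ← exists_or]
  refine and_congr_right fun _ => exists_congr fun k => ?_
  rw [← neg]
  tauto

/-- When `2 d < n`, each neighbour of a vertex is reached by exactly one step. -/
theorem genCycle_adj_indicator {n d : ℕ} (hn : 2 * d < n) (i j : Fin n)
    [Decidable ((genCycle n d).Adj i j)] :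
    (if (genCycle n d).Adj i j then (1 : ℝ) else 0) = ∑ k ∈ Finset.Icc 1 d,
      ((if (n : ℤ) ∣ (i : ℤ) + k - j then (1 : ℝ) else 0) +
        if (n : ℤ) ∣ (i : ℤ) - k - j then 1 else 0) := by
  split_ifs with h
  · obtain ⟨_, k, hk, h⟩ := (genCycle_adj_iff i j).mp h
    rw [Finset.mem_Icc] at hk
    have excl : ∀ l s : ℤ, (n : ℤ) ∣ l → (n : ℤ) ∣ s → l - s ≠ 0 → -n < l - s → l - s < n → False :=
      fun l s hl hs h0 h1 h2 => h0 (Int.eq_zero_of_dvd_of_lt_of_lt (dvd_sub hl hs) h1 h2)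
    rw [Finset.sum_eq_single_of_mem k (Finset.mem_Icc.mpr hk)]
    · rcases h with h | h
      · rw [if_pos h, if_neg, add_zero]
        intro h'
        exact excl _ _ h h' (by omega) (by omega) (by omega)
      · rw [if_pos h, if_neg, zero_add]
        intro h'
        exact excl _ _ h h' (by omega) (by omega) (by omega)
    · intro l hl hlk
      rw [Finset.mem_Icc] at hl
      rw [if_neg, if_neg, add_zero]
      · intro h'
        rcases h with h | h <;> exact excl _ _ h h' (by omega) (by omega) (by omega)
      · intro h'
        rcases h with h | h <;> exact excl _ _ h h' (by omega) (by omega) (by omega)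
  · symm
    apply Finset.sum_eq_zero
    intro k hk
    have hk' := Finset.mem_Icc.mp hk
    rw [genCycle_adj_iff] at h
    by_cases hij : i = j
    · subst hij
      rw [if_neg, if_neg, add_zero]
      · intro h'
        have := Int.eq_zero_of_dvd_of_lt_of_lt h' (by omega) (by omega)
        omega
      · intro h'
        have := Int.eq_zero_of_dvd_of_lt_of_lt h' (by omega) (by omega)
        omega
    · have h1 : ¬ ((n : ℤ) ∣ (i : ℤ) + k - j) := fun h' => h ⟨hij, k, hk, Or.inl h'⟩
      have h2 : ¬ ((n : ℤ) ∣ (i : ℤ) - k - j) := fun h' => h ⟨hij, k, hk, Or.inr h'⟩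
      rw [if_neg h1, if_neg h2, add_zero]

theorem sum_fin_ite_dvd_sub {n : ℕ} (hn : 0 < n) (g : ℤ → ℝ) (hg : ∀ t s, (n : ℤ) ∣ t - s → g t = g s)
    (s : ℤ) : ∑ b : Fin n, (if (n : ℤ) ∣ s - b then (1 : ℝ) else 0) * g b = g s := by
  have hn' : (0 : ℤ) < n := by exact_mod_cast hn
  have h0 := Int.emod_nonneg s hn'.ne'
  have h1 := Int.emod_lt_of_pos s hn'
  have hb : (n : ℤ) ∣ s - (s % n).toNat := by
    rw [Int.toNat_of_nonneg h0]
    exact Int.dvd_self_sub_emod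
  rw [Finset.sum_eq_single_of_mem (⟨(s % n).toNat, by omega⟩ : Fin n) (Finset.mem_univ _)]
  · rw [if_pos hb, one_mul]
    exact (hg _ _ hb).symm
  · intro b _ hne
    rw [if_neg, zero_mul]
    intro h
    apply hne
    have h3 := Int.eq_zero_of_dvd_of_lt_of_lt (dvd_sub h hb) (by have := b.2; omega)
      (by have := b.2; omega)
    ext
    simp only
    omega

open Classical in
theorem lapMatrix_mulVec_eq_sum {m : ℕ} (G : SimpleGraph (Fin m)) (x : Fin m → ℝ) (i : Fin m) :
    (SimpleGraph.lapMatrix ℝ G).mulVec x i =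
      ∑ j, (if G.Adj i j then (1 : ℝ) else 0) * (x i - x j) := by
  rw [SimpleGraph.lapMatrix_mulVec_apply, SimpleGraph.degree_eq_sum_if_adj (R := ℝ)]
  simp only [mul_sub, Finset.sum_sub_distrib, Finset.sum_mul, SimpleGraph.neighborFinset_def]
  congr 1
  simp [Finset.sum_ite, ← SimpleGraph.neighborFinset_eq_filter, SimpleGraph.neighborFinset_def]

open Classical in
theorem lapMatrix_genCycle_mulVec {n d : ℕ} (hn : 2 * d < n) (x : Fin n → ℝ) (i : Fin n) :
    (SimpleGraph.lapMatrix ℝ (genCycle n d)).mulVec x i =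
      ∑ j : Fin n, (∑ k ∈ Finset.Icc 1 d,
        (2 * (if (n : ℤ) ∣ (i : ℤ) - j then (1 : ℝ) else 0) -
          (if (n : ℤ) ∣ (i : ℤ) + k - j then (1 : ℝ) else 0) -
          if (n : ℤ) ∣ (i : ℤ) - k - j then 1 else 0)) * x j := by
  have hone := sum_fin_ite_dvd_sub (n := n) (by omega) (fun _ => 1) (fun _ _ _ => rfl)
  simp only [mul_one] at hone
  have hdiag : ∀ j : Fin n, (n : ℤ) ∣ (i : ℤ) - j ↔ j = i := by
    intro j
    refine ⟨fun h => ?_, by rintro rfl; simp⟩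
    have := Int.eq_zero_of_dvd_of_lt_of_lt h (by have := j.2; omega) (by have := i.2; omega)
    ext
    omega
  rw [lapMatrix_mulVec_eq_sum]
  simp only [genCycle_adj_indicator hn, mul_sub, Finset.sum_sub_distrib, ← Finset.sum_mul]
  rw [Finset.sum_comm]
  simp only [Finset.sum_add_distrib, hone, hdiag, sub_mul, add_mul, Finset.sum_sub_distrib]
  simp
  ring

theorem sum_ite_dvd_mul_periodic {n d : ℕ} (hn : 2 * d < n) (g : ℤ → ℝ)
    (hg : ∀ t s, (n : ℤ) ∣ t - s → g t = g s) (i : Fin n) :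
    ∑ j : Fin n, (∑ k ∈ Finset.Icc 1 d,
        (2 * (if (n : ℤ) ∣ (i : ℤ) - j then (1 : ℝ) else 0) -
          (if (n : ℤ) ∣ (i : ℤ) + k - j then (1 : ℝ) else 0) -
          if (n : ℤ) ∣ (i : ℤ) - k - j then 1 else 0)) * g j =
      ∑ k ∈ Finset.Icc 1 d, (2 * g i - g (i + k) - g (i - k)) := by
  have h := sum_fin_ite_dvd_sub (n := n) (by omega) g hg
  simp only [Finset.sum_mul]
  rw [Finset.sum_comm]
  simp only [sub_mul, mul_assoc, Finset.sum_sub_distrib, ← Finset.mul_sum, h]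

theorem sum_sum_cos_sub_mul {ι : Type*} [Fintype ι] (f x : ι → ℝ) :
    ∑ a, ∑ b, Real.cos (f a - f b) * x b * x a =
      (∑ a, Real.cos (f a) * x a) ^ 2 + (∑ a, Real.sin (f a) * x a) ^ 2 := by
  simp only [sq, Finset.sum_mul_sum, ← Finset.sum_add_distrib, Real.cos_sub]
  refine Finset.sum_congr rfl fun a _ => Finset.sum_congr rfl fun b _ => ?_
  ring

theorem lapQuad_top {m : ℕ} (x : Fin m → ℝ) (hx : ∑ i, x i = 0) :
    lapQuad (⊤ : SimpleGraph (Fin m)) x = m * ∑ i, x i * x i := by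
  have key : ∀ i j : Fin m, (if i ≠ j then (1 : ℝ) else 0) * (x i - x j) = x i - x j := by
    intro i j
    by_cases h : i = j <;> simp [h]
  simp only [lapQuad, lapMatrix_mulVec_eq_sum, SimpleGraph.top_adj, key, Finset.sum_sub_distrib, hx]
  simp [Finset.mul_sum, mul_assoc]

theorem genCycle_eq_top {n d : ℕ} (hn : n ≤ 2 * d + 1) : genCycle n d = ⊤ := by
  ext i j
  rw [SimpleGraph.top_adj, genCycle_adj_iff]
  refine and_iff_left_of_imp fun hij => ?_
  have hij' : (i : ℕ) ≠ j := fun h => hij (Fin.ext h)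
  have hi := i.2
  have hj := j.2
  simp only [Finset.mem_Icc]
  rcases lt_or_gt_of_ne hij' with h | h
  · rcases le_or_gt ((j : ℕ) - i) d with h' | h'
    · exact ⟨j - i, by omega, Or.inl ⟨0, by omega⟩⟩
    · exact ⟨n - (j - i), by omega, Or.inr ⟨-1, by omega⟩⟩
  · rcases le_or_gt ((i : ℕ) - j) d with h' | h'
    · exact ⟨i - j, by omega, Or.inr ⟨0, by omega⟩⟩
    · exact ⟨n - (i - j), by omega, Or.inl ⟨1, by omega⟩⟩

theorem sum_sum_sum_mul_mul_mul {ι κ : Type*} [Fintype ι] (s : Finset κ) (w : κ → ℝ)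
    (c : κ → ι → ι → ℝ) (x : ι → ℝ) :
    ∑ a, ∑ b, (∑ m ∈ s, w m * c m a b) * x b * x a =
      ∑ m ∈ s, w m * ∑ a, ∑ b, c m a b * x b * x a := by
  simp only [Finset.sum_mul, Finset.mul_sum, ← mul_assoc]
  rw [Finset.sum_comm_cycle]

theorem natCast_mul_lapQuad_genCycle {n d : ℕ} (hn : 2 * d < n) (x : Fin n → ℝ) :
    n * lapQuad (genCycle n d) x = ∑ m ∈ Finset.range n,
      (∑ k ∈ Finset.Icc 1 d, 2 * (1 - Real.cos (2 * Real.pi * m * k / n))) *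
        ∑ a : Fin n, ∑ b : Fin n,
          Real.cos (2 * Real.pi * m * a / n - 2 * Real.pi * m * b / n) * x b * x a := by
  have hD : ∀ t : ℤ, (n : ℝ) * (if (n : ℤ) ∣ t then (1 : ℝ) else 0) =
      ∑ m ∈ Finset.range n, Real.cos (2 * Real.pi * m * t / n) := by
    intro t
    rw [sum_cos_eq_ite n (by omega)]
    simp
  have hentry : ∀ a b : Fin n, (n : ℝ) * (∑ k ∈ Finset.Icc 1 d,
        (2 * (if (n : ℤ) ∣ (a : ℤ) - b then (1 : ℝ) else 0) -
          (if (n : ℤ) ∣ (a : ℤ) + k - b then (1 : ℝ) else 0) -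
          if (n : ℤ) ∣ (a : ℤ) - k - b then 1 else 0)) =
      ∑ m ∈ Finset.range n,
        (∑ k ∈ Finset.Icc 1 d, 2 * (1 - Real.cos (2 * Real.pi * m * k / n))) *
          Real.cos (2 * Real.pi * m * a / n - 2 * Real.pi * m * b / n) := by
    intro a b
    simp only [Finset.sum_mul]
    rw [Finset.sum_comm, Finset.mul_sum]
    refine Finset.sum_congr rfl fun k _ => ?_
    rw [mul_sub, mul_sub, mul_left_comm, hD, hD, hD, Finset.mul_sum, ← Finset.sum_sub_distrib,
      ← Finset.sum_sub_distrib]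
    refine Finset.sum_congr rfl fun m _ => ?_
    push_cast
    have e0 : 2 * Real.pi * m * ((a : ℝ) - b) / n =
      2 * Real.pi * m * a / n - 2 * Real.pi * m * b / n := by ring
    have e1 : 2 * Real.pi * m * ((a : ℝ) + k - b) / n =
      (2 * Real.pi * m * a / n - 2 * Real.pi * m * b / n) + 2 * Real.pi * m * k / n := by ring
    have e2 : 2 * Real.pi * m * ((a : ℝ) - k - b) / n =
      (2 * Real.pi * m * a / n - 2 * Real.pi * m * b / n) - 2 * Real.pi * m * k / n := by ring
    rw [e0, e1, e2, Real.cos_add (_ - _), Real.cos_sub (_ - _)]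
    ring
  simp only [lapQuad, lapMatrix_genCycle_mulVec hn]
  rw [← sum_sum_sum_mul_mul_mul]
  simp only [Finset.mul_sum (Finset.univ : Finset (Fin n)), ← mul_assoc, ← hentry,
    Finset.sum_mul (Finset.univ : Finset (Fin n))]

theorem natCast_mul_sum_sq {n : ℕ} (x : Fin n → ℝ) :
    n * ∑ i, x i * x i = ∑ m ∈ Finset.range n, ∑ a : Fin n, ∑ b : Fin n,
          Real.cos (2 * Real.pi * m * a / n - 2 * Real.pi * m * b / n) * x b * x a := by
  have hentry : ∀ a b : Fin n, ∑ m ∈ Finset.range n,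
      Real.cos (2 * Real.pi * m * a / n - 2 * Real.pi * m * b / n) =
        if a = b then (n : ℝ) else 0 := by
    intro a b
    have ha := a.2
    have hb := b.2
    have hab : a = b ↔ (n : ℤ) ∣ (a : ℤ) - b := by
      refine ⟨by rintro rfl; simp, fun h => ?_⟩
      have := Int.eq_zero_of_dvd_of_lt_of_lt h (by omega) (by omega)
      ext
      omega
    simp only [hab]
    rw [← sum_cos_eq_ite n (by omega)]
    refine Finset.sum_congr rfl fun m _ => ?_
    push_cast
    congr 1
    ring
  have h := sum_sum_sum_mul_mul_mul (Finset.range n) (fun _ => 1)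
    (fun m (a b : Fin n) => Real.cos (2 * Real.pi * m * a / n - 2 * Real.pi * m * b / n)) x
  simp only [one_mul, hentry] at h
  rw [← h]
  simp [Finset.mul_sum, mul_assoc]

theorem le_lapQuad_genCycle {n d : ℕ} (hn : 2 * d + 1 < n) (x : Fin n → ℝ) (hx : ∑ i, x i = 0) :
    (∑ k ∈ Finset.Icc 1 d, 2 * (1 - Real.cos (2 * k * Real.pi / n))) * ∑ i, x i * x i ≤
      lapQuad (genCycle n d) x := by
  have hn0 : (0 : ℝ) < n := by
    have : 0 < n := by omega
    exact_mod_cast this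
  refine le_of_mul_le_mul_left ?_ hn0
  rw [natCast_mul_lapQuad_genCycle (by omega), mul_left_comm, natCast_mul_sum_sq, Finset.mul_sum]
  refine Finset.sum_le_sum fun m hm => ?_
  rw [sum_sum_cos_sub_mul]
  rcases Nat.eq_zero_or_pos m with rfl | hm0
  · simp [hx]
  · exact mul_le_mul_of_nonneg_right
      (genCycle_eigenvalue_one_le hn hm0 (Finset.mem_range.mp hm)) (by positivity)

theorem sum_cos_two_pi_mul_div {n : ℕ} (hn : 2 ≤ n) :
    ∑ i : Fin n, Real.cos (2 * Real.pi * (i : ℤ) / n) = 0 := by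
  have h := sum_cos_eq_ite n (by omega) 1
  rw [if_neg, ← Fin.sum_univ_eq_sum_range (fun m => Real.cos (2 * Real.pi * m * (1 : ℤ) / n))] at h
  · simpa using h
  · intro h'
    have := Int.le_of_dvd one_pos h'
    omega

theorem lapQuad_genCycle_cos {n d : ℕ} (hn : 2 * d < n) :
    lapQuad (genCycle n d) (fun i => Real.cos (2 * Real.pi * (i : ℤ) / n)) =
      (∑ k ∈ Finset.Icc 1 d, 2 * (1 - Real.cos (2 * k * Real.pi / n))) *
        ∑ i : Fin n, Real.cos (2 * Real.pi * (i : ℤ) / n) * Real.cos (2 * Real.pi * (i : ℤ) / n) := by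
  have hn0 : (n : ℝ) ≠ 0 := by
    have : n ≠ 0 := by omega
    exact_mod_cast this
  have hg : ∀ t s : ℤ, (n : ℤ) ∣ t - s →
      Real.cos (2 * Real.pi * t / n) = Real.cos (2 * Real.pi * s / n) := by
    rintro t s ⟨c, hc⟩
    have ht : (t : ℝ) = s + n * c := by
      rw [← sub_eq_iff_eq_add']
      exact_mod_cast hc
    rw [← Real.cos_add_int_mul_two_pi (2 * Real.pi * s / n) c, ht]
    congr 1
    field_simp
  simp only [lapQuad, lapMatrix_genCycle_mulVec hn]
  rw [Finset.mul_sum]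
  refine Finset.sum_congr rfl fun i _ => ?_
  rw [sum_ite_dvd_mul_periodic hn (fun t => Real.cos (2 * Real.pi * t / n)) hg, ← mul_assoc]
  congr 1
  rw [Finset.sum_mul]
  refine Finset.sum_congr rfl fun k _ => ?_
  push_cast
  rw [mul_add, mul_sub, add_div, sub_div, Real.cos_add, Real.cos_sub, mul_right_comm 2 (k : ℝ)]
  ring

theorem sum_mul_self_pos {ι : Type*} [Fintype ι] {x : ι → ℝ} (hx : x ≠ 0) :
    0 < ∑ i, x i * x i := by
  obtain ⟨i, hi⟩ := Function.ne_iff.mp hx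
  exact Finset.sum_pos' (fun _ _ => mul_self_nonneg _) ⟨i, Finset.mem_univ _, mul_self_pos.mpr hi⟩

theorem algConn_eq_of_isLeast {m : ℕ} {G : SimpleGraph (Fin m)} {r : ℝ}
    (hle : ∀ x : Fin m → ℝ, ∑ i, x i = 0 → r * ∑ i, x i * x i ≤ lapQuad G x)
    (y : Fin m → ℝ) (hy : y ≠ 0) (hy0 : ∑ i, y i = 0) (heq : lapQuad G y = r * ∑ i, y i * y i) :
    algConn G = r := by
  refine IsLeast.csInf_eq ⟨⟨y, hy, hy0, ?_⟩, ?_⟩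
  · rw [heq, mul_div_cancel_right₀ _ (sum_mul_self_pos hy).ne']
  · rintro _ ⟨x, hx, hx0, rfl⟩
    exact (le_div_iff₀ (sum_mul_self_pos hx)).mpr (hle x hx0)

/-- The algebraic connectivity of the generalized cycle graph `C_{n,d}`
(`n ≥ d + 1`, `d ≥ 1`) equals `n` when `n ≤ 2d + 1`, and equals
`∑_{k=1}^{d} 2(1 - cos(2kπ/n))` when `n ≥ 2d + 2`. -/
theorem algConn_genCycle (d n : ℕ) (hd : 1 ≤ d) (hn : d + 1 ≤ n) :
    (n ≤ 2 * d + 1 → algConn (genCycle n d) = n) ∧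
    (2 * d + 2 ≤ n → algConn (genCycle n d) =
      ∑ k ∈ Finset.Icc 1 d, 2 * (1 - Real.cos (2 * (k : ℝ) * Real.pi / (n : ℝ)))) := by
  have hcos := sum_cos_two_pi_mul_div (n := n) (by omega)
  have hne : (fun i : Fin n => Real.cos (2 * Real.pi * (i : ℤ) / n)) ≠ 0 := by
    intro h
    simpa using congrFun h ⟨0, by omega⟩
  refine ⟨fun h => ?_, fun h => ?_⟩
  · rw [genCycle_eq_top h]
    exact algConn_eq_of_isLeast (fun x hx => (lapQuad_top x hx).ge) _ hne hcos
      (lapQuad_top _ hcos)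
  · exact algConn_eq_of_isLeast (le_lapQuad_genCycle (by omega)) _ hne hcos
      (lapQuad_genCycle_cos (by omega))
end

section
/- Let d, n ∈ ℕ with n ≥ d + 1. Define v : {1, …, n} → ℝ by v_i = (1/√n)·cos(π·(i − 1/2)/n), and define w : {1, …, 2n} → ℝ by w_i = v_i for 1 ≤ i ≤ n and w_{n+i} = −v_i for 1 ≤ i ≤ n. Then 2·Σ_{{i,j} ∈ E(P_{n,d})} (v_i − v_j)² ≤ Σ_{{i,j} ∈ E(C_{2n,d})} (w_i − w_j)², i.e., 2·⟨L(P_{n,d}) v, v⟩ ≤ ⟨L(C_{2n,d}) w, w⟩. -/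
lemma lapQuad_eq_sum {m : ℕ} (G : SimpleGraph (Fin m)) (x : Fin m → ℝ) :
    lapQuad G x = (∑ p : Fin m × Fin m, {q | G.Adj q.1 q.2}.indicator
      (fun q => (x q.1 - x q.2) ^ 2) p) / 2 := by
  classical
  have h := SimpleGraph.lapMatrix_toLinearMap₂' ℝ G x
  rw [Matrix.toLinearMap₂'_apply', dotProduct_comm] at h
  rw [Fintype.sum_prod_type]
  simp only [Set.indicator_apply, Set.mem_ofPred_eq]
  convert h using 1
  unfold lapQuad dotProduct
  congr!

/-- If the vertices of `H` embed into those of `G` in two disjoint ways, both preserving adjacency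
and the squared differences of the labels, then twice the form of `H` is at most that of `G`. -/
lemma two_mul_lapQuad_le {n m : ℕ} {H : SimpleGraph (Fin n)} {G : SimpleGraph (Fin m)}
    {x : Fin n → ℝ} {y : Fin m → ℝ} (f g : H →g G)
    (hf : Function.Injective f) (hg : Function.Injective g) (hfg : ∀ i j, f i ≠ g j)
    (hxf : ∀ i j, (y (f i) - y (f j)) ^ 2 = (x i - x j) ^ 2)
    (hxg : ∀ i j, (y (g i) - y (g j)) ^ 2 = (x i - x j) ^ 2) :
    2 * lapQuad H x ≤ lapQuad G y := by
  set F : Fin m × Fin m → ℝ := {q | G.Adj q.1 q.2}.indicator (fun q => (y q.1 - y q.2) ^ 2) with hF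
  have hF0 : ∀ p, 0 ≤ F p := fun p => Set.indicator_nonneg (fun _ _ => sq_nonneg _) p
  let e : (Fin n × Fin n) ⊕ (Fin n × Fin n) → Fin m × Fin m :=
    Sum.elim (Prod.map f f) (Prod.map g g)
  have he : Function.Injective e :=
    (hf.prodMap hf).sumElim (hg.prodMap hg) fun p q h => hfg _ _ (congrArg Prod.fst h)
  have hle (k : H →g G) (hk : ∀ i j, (y (k i) - y (k j)) ^ 2 = (x i - x j) ^ 2)
      (p : Fin n × Fin n) :
      {q | H.Adj q.1 q.2}.indicator (fun q => (x q.1 - x q.2) ^ 2) p ≤ F (Prod.map k k p) := by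
    refine Set.indicator_apply_le' (fun h => ?_) fun _ => hF0 _
    have hk' : Prod.map k k p ∈ {q : Fin m × Fin m | G.Adj q.1 q.2} := k.map_adj h
    rw [hF, Set.indicator_of_mem hk']
    exact (hk p.1 p.2).ge
  have hsum : ∑ s, F (e s) ≤ ∑ p, F p := by
    simpa using Finset.sum_le_univ_sum_of_nonneg (s := Finset.univ.map ⟨e, he⟩) hF0
  rw [Fintype.sum_sum_type] at hsum
  have h₁ := Finset.sum_le_sum fun p (_ : p ∈ Finset.univ) => hle f hxf p
  have h₂ := Finset.sum_le_sum fun p (_ : p ∈ Finset.univ) => hle g hxg p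
  rw [lapQuad_eq_sum, lapQuad_eq_sum]
  simp only [e, Sum.elim_inl, Sum.elim_inr] at hsum
  linarith

/-- Translation by `c` embeds the generalized path into a longer generalized cycle. -/
def genPathShift {n m d : ℕ} (c : ℕ) (hc : c + n ≤ m) : genPath n d →g genCycle m d where
  toFun i := ⟨c + i, by omega⟩
  map_rel' {i j} h := by
    have key : ∀ a b : Fin n, (a : ℕ) < b → (b : ℕ) - a ≤ d →
        ∃ k, 1 ≤ k ∧ k ≤ d ∧ (c + a + k) % m = c + b := fun a b hab hd =>
      ⟨b - a, by omega, hd, by rw [Nat.mod_eq_of_lt] <;> omega⟩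
    simp only [genPath, genCycle, SimpleGraph.fromRel_adj, ne_eq, Fin.ext_iff] at h ⊢
    obtain ⟨hne, h | h⟩ := h
    · exact ⟨by omega, Or.inl (key i j h.1 h.2)⟩
    · exact ⟨by omega, Or.inr (key j i h.1 h.2)⟩

lemma genPathShift_injective {n m d c : ℕ} (hc : c + n ≤ m) :
    Function.Injective (genPathShift (d := d) c hc) := fun i j h => by
  have : c + (i : ℕ) = c + j := congrArg Fin.val h
  omega

/-- With `v i = (1/√n)·cos(π(i - 1/2)/n)` for labels `i ∈ {1, …, n}`
(label `i` is the index `i - 1 : Fin n`) and `w` equal to `v` on the first `n` vertices and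
`-v` on the last `n`, one has `2⟨L(P_{n,d}) v, v⟩ ≤ ⟨L(C_{2n,d}) w, w⟩`. -/
theorem mirror_path_quadform_le (d n : ℕ) (hd : 1 ≤ d) (hn : d + 1 ≤ n)
    (v : Fin n → ℝ)
    (hv : ∀ i : Fin n, v i =
      (1 / Real.sqrt n) * Real.cos (Real.pi * (((i : ℕ) : ℝ) + 1 - 1 / 2) / n))
    (w : Fin (2 * n) → ℝ)
    (hw : ∀ i : Fin (2 * n), w i =
      if h : (i : ℕ) < n then v ⟨(i : ℕ), h⟩
      else -v ⟨(i : ℕ) - n, by have := i.isLt; omega⟩) :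
    2 * lapQuad (genPath n d) v ≤ lapQuad (genCycle (2 * n) d) w := by
  have hlow (i : Fin n) : w (genPathShift (d := d) 0 (by omega) i) = v i := by
    simp [hw, genPathShift]
  have hhigh (i : Fin n) : w (genPathShift (d := d) n (by omega) i) = -v i := by
    simp [hw, genPathShift]
  refine two_mul_lapQuad_le _ _ (genPathShift_injective (by omega : 0 + n ≤ 2 * n))
    (genPathShift_injective (by omega : n + n ≤ 2 * n)) (fun i j h => ?_)
    (fun i j => by rw [hlow, hlow]) (fun i j => by rw [hhigh, hhigh]; ring)
  have : 0 + (i : ℕ) = n + j := congrArg Fin.val h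
  omega
end

section
/- Let d, n ∈ ℕ with d ≥ 1 and n ≥ d + 2, and let S_{n,d} be the generalized star graph. Then the multiset of eigenvalues (with multiplicity) of the Laplacian matrix L(S_{n,d}) is {0 with multiplicity 1, d with multiplicity n − d − 1, n with multiplicity d}. -/
/-- The generalized star graph `S_{n,d}` on vertex set `Fin n` (vertex `i` stands for the
label `i + 1 ∈ {1, …, n}`): distinct vertices are adjacent iff one of them is among the
first `d` vertices. -/
def genStar (n d : ℕ) : SimpleGraph (Fin n) :=
  SimpleGraph.fromRel (fun i _j => (i : ℕ) < d)

open Matrix in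
open Classical in
theorem genStar_lapMatrix_apply (d m : ℕ) (i j : Fin (d + m)) :
    SimpleGraph.lapMatrix ℝ (genStar (d + m) d) i j =
      (if i = j then (if (i : ℕ) < d then ((d + m : ℕ) : ℝ) else (d : ℝ)) else 0) -
        (if (i : ℕ) < d ∨ (j : ℕ) < d then 1 else 0) := by
  have hdeg : ((genStar (d + m) d).degree i : ℝ) =
      (if (i : ℕ) < d then ((d + m : ℕ) : ℝ) - 1 else (d : ℝ)) := by
    have h1 : ((genStar (d + m) d).degree i : ℝ) =
        ∑ j : Fin (d + m), ((if (i : ℕ) < d ∨ (j : ℕ) < d then (1 : ℝ) else 0) -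
          if i = j then (if (i : ℕ) < d then 1 else 0) else 0) := by
      rw [← SimpleGraph.card_neighborFinset_eq_degree, SimpleGraph.neighborFinset_eq_filter,
        Finset.card_filter]
      push_cast
      refine Finset.sum_congr rfl fun j _ => ?_
      by_cases hij : i = j
      · subst hij
        simp
      · simp [genStar, hij]
    rw [h1, Finset.sum_sub_distrib, Fin.sum_univ_add]
    by_cases hi : (i : ℕ) < d <;> simp [hi]
  rw [SimpleGraph.lapMatrix, Matrix.sub_apply, SimpleGraph.degMatrix, diagonal_apply,
    SimpleGraph.adjMatrix_apply]
  by_cases hij : i = j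
  · subst hij
    rw [if_pos rfl, hdeg]
    by_cases hi : (i : ℕ) < d <;> simp [hi]
  · simp [genStar, hij]

open Matrix Polynomial in
open Classical in
theorem genStar_lapMatrix_charpoly (d m : ℕ) :
    (SimpleGraph.lapMatrix ℝ (genStar (d + (m + 1)) d)).charpoly =
      X * (X - C (d : ℝ)) ^ m * (X - C ((d + (m + 1) : ℕ) : ℝ)) ^ d := by
  refine eq_of_infinite_eval_eq _ _ (Set.Infinite.mono (s := {(d : ℝ), ((d + (m + 1) : ℕ) : ℝ)}ᶜ)
    ?_ (Set.Finite.infinite_compl (by simp)))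
  intro t ht
  simp only [Set.mem_compl_iff, Set.mem_insert_iff, Set.mem_singleton_iff, not_or] at ht
  have hd : t - (d : ℝ) ≠ 0 := sub_ne_zero.2 ht.1
  have hn : t - ((d + (m + 1) : ℕ) : ℝ) ≠ 0 := sub_ne_zero.2 ht.2
  let c : Fin (d + (m + 1)) → ℝ := fun i =>
    if (i : ℕ) < d then t - ((d + (m + 1) : ℕ) : ℝ) else t - d
  let U : Matrix (Fin (d + (m + 1))) (Fin 2) ℝ :=
    of fun i => ![if (i : ℕ) < d then 1 else 0, if (i : ℕ) < d then 0 else 1]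
  let V : Matrix (Fin 2) (Fin (d + (m + 1))) ℝ :=
    of ![fun _ => 1, fun j => if (j : ℕ) < d then 1 else 0]
  have hc : ∀ i, c i ≠ 0 := fun i => by
    simp only [c]; split_ifs <;> assumption
  have hdecomp : scalar (Fin (d + (m + 1))) t - SimpleGraph.lapMatrix ℝ (genStar (d + (m + 1)) d) =
      diagonal c + U * V := by
    ext i j
    rw [Matrix.sub_apply, genStar_lapMatrix_apply, scalar_apply, diagonal_apply, Matrix.add_apply,
      diagonal_apply, mul_apply, Fin.sum_univ_two]
    simp only [c, U, V, of_apply, cons_val_zero, cons_val_one]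
    by_cases hij : i = j <;> by_cases hi : (i : ℕ) < d <;> by_cases hj : (j : ℕ) < d <;>
      simp [hij, hi, hj]
    all_goals grind
  have hinv : (diagonal c)⁻¹ = diagonal fun i => (c i)⁻¹ := by
    refine inv_eq_left_inv ?_
    rw [diagonal_mul_diagonal, ← diagonal_one]
    congr 1
    ext i
    exact inv_mul_cancel₀ (hc i)
  have hdet : IsUnit (diagonal c).det := by
    rw [det_diagonal]
    exact (Finset.prod_ne_zero_iff.2 fun i _ => hc i).isUnit
  have hprod : (diagonal c).det = (t - ((d + (m + 1) : ℕ) : ℝ)) ^ d * (t - d) ^ (m + 1) := by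
    rw [det_diagonal, Fin.prod_univ_add]
    simp [c]
  have hsmall : (1 + V * (diagonal c)⁻¹ * U).det = t / (t - d) := by
    rw [hinv, det_fin_two]
    simp only [Matrix.add_apply, mul_apply (N := U), mul_diagonal, Fin.sum_univ_add]
    simp only [c, U, V]
    simp
    push_cast at hn
    field_simp
    ring
  rw [Set.mem_ofPred_eq, Matrix.eval_charpoly, hdecomp, det_add_mul U V hdet, hprod, hsmall]
  simp only [eval_mul, eval_pow, eval_sub, eval_X, eval_C]
  field_simp
  ring

open Classical in
/-- For `d ≥ 1` and `n ≥ d + 2`, the Laplacian eigenvalues (with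
multiplicity) of the generalized star graph `S_{n,d}` are
`{0^(1), d^(n-d-1), n^(d)}`. -/
theorem genStar_lap_eigenvalues (d n : ℕ) (hd : 1 ≤ d) (hn : d + 2 ≤ n) :
    (SimpleGraph.lapMatrix ℝ (genStar n d)).charpoly.roots =
      Multiset.replicate 1 (0 : ℝ) + Multiset.replicate (n - d - 1) (d : ℝ) +
        Multiset.replicate d (n : ℝ) := by
  obtain ⟨m, rfl⟩ : ∃ m, n = d + (m + 1) := ⟨n - d - 1, by omega⟩
  have hm : d + (m + 1) - d - 1 = m := by omega
  rw [genStar_lapMatrix_charpoly, hm, Polynomial.roots_mul, Polynomial.roots_mul]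
  · rw [Polynomial.roots_pow, Polynomial.roots_pow, Polynomial.roots_X, Polynomial.roots_X_sub_C,
      Polynomial.roots_X_sub_C, Multiset.nsmul_singleton, Multiset.nsmul_singleton,
      Multiset.replicate_one]
  · exact mul_ne_zero Polynomial.X_ne_zero (pow_ne_zero _ (Polynomial.X_sub_C_ne_zero _))
  · exact mul_ne_zero (mul_ne_zero Polynomial.X_ne_zero
      (pow_ne_zero _ (Polynomial.X_sub_C_ne_zero _))) (pow_ne_zero _ (Polynomial.X_sub_C_ne_zero _))
end

section
/- Let k, r ∈ ℕ with k ≥ 2 and r ≥ 2, and let T_{kr,r} be the Turán graph on k·r vertices. Then the multiset of eigenvalues (with multiplicity) of the Laplacian matrix L(T_{kr,r}) is {0 with multiplicity 1, k·(r − 1) with multiplicity (k − 1)·r, k·r with multiplicity r − 1}. -/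
/-- The Turán graph `T_{kr,r}` on vertex set `Fin (k*r)` (vertex `i` stands for the label
`i + 1 ∈ {1, …, kr}`): distinct vertices `i, j` are adjacent iff `(i - j) mod r ≠ 0`. -/
def turanGraph' (k r : ℕ) : SimpleGraph (Fin (k * r)) :=
  SimpleGraph.fromRel (fun i j => (i : ℕ) % r ≠ (j : ℕ) % r)

open Polynomial in
theorem Matrix.charpoly_add_scalar {R n : Type*} [CommRing R] [Fintype n] [DecidableEq n]
    (M : Matrix n n R) (μ : R) :
    (M + Matrix.scalar n μ).charpoly = M.charpoly.comp (X - C μ) := by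
  have h := Matrix.charpoly_sub_scalar M (-μ)
  rwa [map_neg, sub_neg_eq_add, map_neg, ← sub_eq_add_neg] at h

theorem Fin.sum_comp_modNat {M : Type*} [AddCommMonoid M] {k r : ℕ} (f : Fin r → M) :
    ∑ i : Fin (k * r), f i.modNat = k • ∑ a, f a := by
  calc
    ∑ i : Fin (k * r), f i.modNat = ∑ x : Fin k × Fin r, f x.2 :=
      finProdFinEquiv.symm.sum_comp fun x : Fin k × Fin r => f x.2
    _ = k • ∑ a, f a := by simp [Fintype.sum_prod_type]

theorem turanGraph'_adj {k r : ℕ} {i j : Fin (k * r)} :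
    (turanGraph' k r).Adj i j ↔ i.modNat ≠ j.modNat := by
  rw [turanGraph', SimpleGraph.fromRel_adj, ne_comm (a := (j : ℕ) % r), or_self, ne_eq i.modNat,
    Fin.ext_iff, Fin.coe_modNat, Fin.coe_modNat]
  exact and_iff_right_of_imp fun h hij => h (by rw [hij])

/-- The matrix whose rows are the indicator vectors of the parts containing the vertices of
`T_{kr,r}`. -/
def turanPartMatrix (k r : ℕ) : Matrix (Fin (k * r)) (Fin r) ℝ :=
  (1 : Matrix (Fin r) (Fin r) ℝ).submatrix Fin.modNat id

section

open Matrix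

theorem turanPartMatrix_transpose_mul_self (k r : ℕ) :
    (turanPartMatrix k r)ᵀ * turanPartMatrix k r = Matrix.scalar (Fin r) (k : ℝ) := by
  ext a b
  simp only [turanPartMatrix, Matrix.mul_apply, transpose_apply, submatrix_apply]
  refine (Fin.sum_comp_modNat fun c => (1 : Matrix (Fin r) (Fin r) ℝ) c a *
    (1 : Matrix (Fin r) (Fin r) ℝ) c b).trans ?_
  rw [scalar_apply, diagonal_apply]
  simp [Matrix.one_apply, eq_comm]

theorem turanPartMatrix_mul_mul_transpose (k r : ℕ) (M : Matrix (Fin r) (Fin r) ℝ) :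
    turanPartMatrix k r * (M * (turanPartMatrix k r)ᵀ) = M.submatrix Fin.modNat Fin.modNat := by
  ext i j
  simp [turanPartMatrix, Matrix.mul_apply, Matrix.one_apply]

theorem turanGraph'_degree {k r : ℕ} [DecidableRel (turanGraph' k r).Adj] (i : Fin (k * r)) :
    ((turanGraph' k r).degree i : ℝ) = k * (r - 1) := by
  simp only [SimpleGraph.degree_eq_sum_if_adj, turanGraph'_adj]
  rw [Fin.sum_comp_modNat fun a => if i.modNat ≠ a then (1 : ℝ) else 0]
  have hr : 1 ≤ r := Fin.pos i.modNat
  simp [Finset.sum_ite, Finset.filter_ne, Nat.cast_sub hr]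

theorem turanGraph'_lapMatrix (k r : ℕ) [DecidableRel (turanGraph' k r).Adj] :
    (turanGraph' k r).lapMatrix ℝ =
      turanPartMatrix k r * ((1 - vecMulVec 1 1 : Matrix (Fin r) (Fin r) ℝ) *
        (turanPartMatrix k r)ᵀ) + Matrix.scalar (Fin (k * r)) ((k : ℝ) * (r - 1)) := by
  rw [turanPartMatrix_mul_mul_transpose]
  ext i j
  simp only [SimpleGraph.lapMatrix, SimpleGraph.degMatrix, turanGraph'_degree, Matrix.sub_apply,
    Matrix.add_apply, SimpleGraph.adjMatrix_apply, turanGraph'_adj, submatrix_apply,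
    Matrix.one_apply, vecMulVec_apply, scalar_apply, diagonal_apply,
    Pi.one_apply]
  split_ifs <;> simp_all

open Polynomial in
theorem turanGraph'_charpoly_lapMatrix {k r : ℕ} (hk : 1 ≤ k) (hr : 1 ≤ r)
    [DecidableRel (turanGraph' k r).Adj] :
    ((turanGraph' k r).lapMatrix ℝ).charpoly =
      X * (X - C ((k : ℝ) * (r - 1))) ^ ((k - 1) * r) * (X - C ((k : ℝ) * r)) ^ (r - 1) := by
  have hle : Fintype.card (Fin r) ≤ Fintype.card (Fin (k * r)) := by
    simpa using Nat.le_mul_of_pos_left r hk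
  have hM : (1 - vecMulVec 1 1 : Matrix (Fin r) (Fin r) ℝ) * Matrix.scalar (Fin r) (k : ℝ) =
      vecMulVec (fun _ => -(k : ℝ)) 1 + Matrix.scalar (Fin r) (k : ℝ) := by
    ext a b
    rw [scalar_apply, mul_diagonal]
    simp only [Matrix.sub_apply, Matrix.add_apply, Matrix.one_apply, diagonal_apply,
      vecMulVec_apply, Pi.one_apply]
    split_ifs <;> ring
  rw [turanGraph'_lapMatrix, charpoly_add_scalar, charpoly_mul_comm_of_le _ _ hle,
    Matrix.mul_assoc, turanPartMatrix_transpose_mul_self, hM, charpoly_add_scalar,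
    charpoly_vecMulVec]
  obtain ⟨s, rfl⟩ := Nat.exists_eq_add_of_le' hr
  simp [dotProduct, Nat.sub_mul, smul_eq_C_mul]
  ring

end

open Classical in
/-- For `k, r ≥ 2`, the Laplacian eigenvalues (with multiplicity) of the
Turán graph `T_{kr,r}` are `{0^(1), (k(r-1))^((k-1)r), (kr)^(r-1)}`. -/
theorem turan_lap_eigenvalues (k r : ℕ) (hk : 2 ≤ k) (hr : 2 ≤ r) :
    (SimpleGraph.lapMatrix ℝ (turanGraph' k r)).charpoly.roots =
      Multiset.replicate 1 (0 : ℝ) + Multiset.replicate ((k - 1) * r) ((k : ℝ) * ((r : ℝ) - 1)) +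
        Multiset.replicate (r - 1) ((k : ℝ) * (r : ℝ)) := by
  rw [turanGraph'_charpoly_lapMatrix (by lia) (by lia)]
  have hX (a : ℝ) (n : ℕ) : (Polynomial.X - Polynomial.C a) ^ n ≠ 0 :=
    pow_ne_zero n (Polynomial.X_sub_C_ne_zero a)
  rw [Polynomial.roots_mul (mul_ne_zero (mul_ne_zero Polynomial.X_ne_zero (hX _ _)) (hX _ _)),
    Polynomial.roots_mul (mul_ne_zero Polynomial.X_ne_zero (hX _ _))]
  simp only [Polynomial.roots_pow, Polynomial.roots_X_sub_C, Polynomial.roots_X,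
    Multiset.nsmul_singleton, Multiset.replicate_one]
end
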